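/- For all α, β ∈ 𝒵 and each i = 1,…,r−1, one has tr(φ_i(α)φ_i(I_N)^{−1}φ_i(β)φ_i(I_N)^{−1}) − tr(φ̌_i(α)φ̌_i(I_N)^{−1}φ̌_i(β)φ̌_i(I_N)^{−1}) = α_{ii}β_{ii} + 2 Σ_{l=i+1}^{r} (n_l/n_i)(α_{li}|β_{li}), where α_{ii}, β_{ii} are the scalar diagonal entries and α_{li}, β_{li} ∈ 𝒱_{li} the off-diagonal blocks. -/

import Mathlib

open Matrix MeasureTheory Finset
open scoped ENNReal

namespace Wishart

instance {m n α : Type*} [MeasurableSpace α] : MeasurableSpace (Matrix m n α) :=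
  inferInstanceAs (MeasurableSpace (m → n → α))

/-- Index set of an `N × N` matrix partitioned into `r + 1` blocks of sizes `n 0, …, n r`. -/
abbrev Idx (r : ℕ) (n : Fin (r + 1) → ℕ+) := Σ k : Fin (r + 1), Fin (n k)

/-- Real matrices over the partitioned index set. -/
abbrev Mat (r : ℕ) (n : Fin (r + 1) → ℕ+) := Matrix (Idx r n) (Idx r n) ℝ

variable {r : ℕ} {n : Fin (r + 1) → ℕ+}

/-- The `(l,k)` block of a partitioned matrix. -/
def blk (x : Mat r n) (l k : Fin (r + 1)) : Matrix (Fin (n l)) (Fin (n k)) ℝ :=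
  Matrix.of fun a b => x ⟨l, a⟩ ⟨k, b⟩

variable (V : ∀ l k : Fin (r + 1), Submodule ℝ (Matrix (Fin (n l)) (Fin (n k)) ℝ))

/-- Condition (V1): `A ∈ 𝒱_{lk}`, `B ∈ 𝒱_{ki}` implies `A B ∈ 𝒱_{li}` for `i < k < l`. -/
def CondV1 : Prop := ∀ i k l : Fin (r + 1), i < k → k < l →
  ∀ A ∈ V l k, ∀ B ∈ V k i, A * B ∈ V l i

/-- Condition (V2): `A ∈ 𝒱_{li}`, `B ∈ 𝒱_{ki}` implies `A Bᵀ ∈ 𝒱_{lk}` for `i < k < l`. -/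
def CondV2 : Prop := ∀ i k l : Fin (r + 1), i < k → k < l →
  ∀ A ∈ V l i, ∀ B ∈ V k i, A * Bᵀ ∈ V l k

/-- Condition (V3): `A ∈ 𝒱_{lk}` implies `A Aᵀ ∈ ℝ I`. -/
def CondV3 : Prop := ∀ k l : Fin (r + 1), k < l →
  ∀ A ∈ V l k, ∃ c : ℝ, A * Aᵀ = c • (1 : Matrix (Fin (n l)) (Fin (n l)) ℝ)

/-- The space `𝒵` of symmetric matrices with lower blocks in `𝒱_{lk}` and scalar diagonal
blocks. -/
def Zspace : Set (Mat r n) :=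
  {x | x.IsSymm ∧ (∀ k l : Fin (r + 1), k < l → blk x l k ∈ V l k) ∧
    ∀ k : Fin (r + 1), ∃ c : ℝ, ∀ a b : Fin (n k),
      x ⟨k, a⟩ ⟨k, b⟩ = if a = b then c else 0}

/-- The trace inner product `⟨x, y⟩ = tr (x y)`. -/
def tip (x y : Mat r n) : ℝ := (x * y).trace

/-- The homogeneous cone `𝒫 = 𝒵 ∩ Sym₊(N, ℝ)`. -/
def Pcone : Set (Mat r n) := {x | x ∈ Zspace V ∧ x.PosDef}

/-- The dual cone `𝒬 = {ξ ∈ 𝒵 : ⟨ξ, x⟩ > 0 for all nonzero x in the closure of 𝒫}`. -/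
def Qcone : Set (Mat r n) :=
  {ξ | ξ ∈ Zspace V ∧ ∀ x ∈ closure (Pcone V), x ≠ 0 → 0 < tip ξ x}

/-- The group `H` of block lower triangular matrices with strictly lower blocks in `𝒱_{lk}`
and positive scalar diagonal blocks. -/
def Hgrp : Set (Mat r n) :=
  {T | (∀ k l : Fin (r + 1), l < k → blk T l k = 0) ∧
    (∀ k l : Fin (r + 1), k < l → blk T l k ∈ V l k) ∧
    ∀ k : Fin (r + 1), ∃ t : ℝ, 0 < t ∧ ∀ a b : Fin (n k),
      T ⟨k, a⟩ ⟨k, b⟩ = if a = b then t else 0}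

/-- `ρ(T) x = T x Tᵀ`. -/
def rhoM (T x : Mat r n) : Mat r n := T * x * Tᵀ

/-- The diagonal scalar `t_{kk}` of a matrix with scalar diagonal blocks. -/
def tdiag (T : Mat r n) (k : Fin (r + 1)) : ℝ :=
  T ⟨k, ⟨0, (n k).2⟩⟩ ⟨k, ⟨0, (n k).2⟩⟩

/-- The one-dimensional representation `χ_s(T) = ∏_k t_{kk}^{2 s_k}`. -/
noncomputable def chi (s : Fin (r + 1) → ℝ) (T : Mat r n) : ℝ :=
  ∏ k : Fin (r + 1), tdiag T k ^ (2 * s k)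

/-- `½ Σ_{i<k} ε_i dim 𝒱_{ki}`. -/
noncomputable def xiBound (ε : Fin (r + 1) → Bool) (k : Fin (r + 1)) : ℝ :=
  (1 / 2) * ∑ i ∈ Finset.univ.filter (fun i => i < k),
    (if ε i then (Module.finrank ℝ (V k i) : ℝ) else 0)

/-- The Gindikin set `Ξ`. -/
def XiSet : Set (Fin (r + 1) → ℝ) :=
  ⋃ ε : Fin (r + 1) → Bool,
    {s | ∀ k, (ε k = true → xiBound V ε k < s k) ∧ (ε k = false → s k = xiBound V ε k)}

/-- `½ Σ_{l>k} ε_l dim 𝒱_{lk}`. -/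
noncomputable def frakBound (ε : Fin (r + 1) → Bool) (k : Fin (r + 1)) : ℝ :=
  (1 / 2) * ∑ l ∈ Finset.univ.filter (fun l => k < l),
    (if ε l then (Module.finrank ℝ (V l k) : ℝ) else 0)

/-- The Gindikin set `𝔛`. -/
def frakX : Set (Fin (r + 1) → ℝ) :=
  ⋃ ε : Fin (r + 1) → Bool,
    {s | ∀ k, (ε k = true → frakBound V ε k < s k) ∧ (ε k = false → s k = frakBound V ε k)}

/-- Laplace transform `L_μ(θ) = ∫ e^{-⟨θ,x⟩} dμ(x)` (with values in `[0,∞]`). -/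
noncomputable def laplace (μ : Measure (Mat r n)) (θ : Mat r n) : ℝ≥0∞ :=
  ∫⁻ x, ENNReal.ofReal (Real.exp (-(tip θ x))) ∂μ

/-- Real-valued Laplace transform. -/
noncomputable def laplaceR (μ : Measure (Mat r n)) (θ : Mat r n) : ℝ :=
  ∫ x, Real.exp (-(tip θ x)) ∂μ

/-- Mean of the natural-exponential-family member `P(θ,μ)`, computed entrywise:
`m_μ(θ) = L_μ(θ)⁻¹ ∫ x e^{-⟨θ,x⟩} dμ(x)`. -/
noncomputable def meanMap (μ : Measure (Mat r n)) (θ : Mat r n) : Mat r n :=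
  Matrix.of fun p q => (laplaceR μ θ)⁻¹ * ∫ x, Real.exp (-(tip θ x)) * x p q ∂μ

/-- Covariance operator of `P(θ,μ)` with mean `m`, applied to `ξ ∈ 𝒵` (entrywise):
`V ξ = ∫ ⟨ξ, x - m⟩ (x - m) dP(θ,μ)(x)`. -/
noncomputable def varOp (μ : Measure (Mat r n)) (θ m ξ : Mat r n) : Mat r n :=
  Matrix.of fun p q =>
    (laplaceR μ θ)⁻¹ * ∫ x, Real.exp (-(tip θ x)) * tip ξ (x - m) * ((x - m) p q) ∂μ

/-- Leading principal submatrix `y_{{1:k}}` consisting of the blocks with indices `≤ k`. -/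
def lead (k : Fin (r + 1)) (y : Mat r n) :
    Matrix {p : Idx r n // p.1 ≤ k} {p : Idx r n // p.1 ≤ k} ℝ :=
  Matrix.of fun p q => y p.1 q.1

/-- Zero-padding `z₀` of a matrix `z` defined on the blocks with indices `≤ k`. -/
def pad (k : Fin (r + 1)) (z : Matrix {p : Idx r n // p.1 ≤ k} {p : Idx r n // p.1 ≤ k} ℝ) :
    Mat r n :=
  Matrix.of fun p q => if h : p.1 ≤ k ∧ q.1 ≤ k then z ⟨p, h.1⟩ ⟨q, h.2⟩ else 0

/-- `J_k = (I_{N_k})₀`. -/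
def Jmat (k : Fin (r + 1)) : Mat r n := pad k 1

/-- Parameters of elements of `W_i`: the scalar `x_{ii}` and the blocks `X_{li}`. -/
abbrev Wparam (r : ℕ) (n : Fin (r + 1) → ℕ+) (i : Fin (r + 1)) :=
  ℝ × ∀ l : Fin (r + 1), Matrix (Fin (n l)) (Fin (n i)) ℝ

/-- The `N × n_i` matrix in `W_i` with `i`-th block row `x_{ii} I` and `l`-th block row
`X_{li}` for `l > i`. -/
def toW (i : Fin (r + 1)) (p : Wparam r n i) : Matrix (Idx r n) (Fin (n i)) ℝ :=
  Matrix.of fun q b =>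
    if q.1 = i then (if (q.2 : ℕ) = (b : ℕ) then p.1 else 0)
    else if i < q.1 then p.2 q.1 q.2 b else 0

/-- A parameter tuple gives an honest element of `W_i`: blocks lie in `𝒱_{li}` and vanish
for `l ≤ i`. -/
def WGood (i : Fin (r + 1)) (p : Wparam r n i) : Prop :=
  (∀ l : Fin (r + 1), i < l → p.2 l ∈ V l i) ∧ (∀ l : Fin (r + 1), ¬ i < l → p.2 l = 0)

/-- The inner product `(A|B)` on `𝒱_{lk}`, characterized by `(ABᵀ + BAᵀ)/2 = (A|B) I`. -/
noncomputable def bip (l : Fin (r + 1)) {k : Fin (r + 1)}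
    (A B : Matrix (Fin (n l)) (Fin (n k)) ℝ) : ℝ :=
  (A * Bᵀ).trace / (n l : ℝ)

open scoped Classical in
/-- The generalized power function `Δ_s` on `𝒫`, defined by `Δ_s(ρ(T) I) = χ_s(T)`. -/
noncomputable def DeltaDef (s : Fin (r + 1) → ℝ) (x : Mat r n) : ℝ :=
  if h : ∃ T, T ∈ Hgrp V ∧ x = rhoM T 1 then chi s h.choose else 0

/-- Index set for the block diagonal matrix `Φ(ξ) = diag(φ_0(ξ), …, φ_r(ξ))`,
where `φ_i(ξ)` is of size `m_i = mdc i + 1`. -/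
abbrev DIdx (r : ℕ) (mdc : Fin (r + 1) → ℕ) := Σ i : Fin (r + 1), Fin (mdc i + 1)

/-- The block diagonal matrix `Φ(ξ) = diag(φ_0(ξ), …, φ_r(ξ))`. -/
def PhiMat {mdc : Fin (r + 1) → ℕ}
    (φ : ∀ i : Fin (r + 1), Mat r n → Matrix (Fin (mdc i + 1)) (Fin (mdc i + 1)) ℝ)
    (ξ : Mat r n) : Matrix (DIdx r mdc) (DIdx r mdc) ℝ :=
  Matrix.of fun p q =>
    if h : p.1 = q.1 then φ p.1 ξ p.2 (Fin.cast (by rw [h]) q.2) else 0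

/-- `Φ(I_N)^{-1/2}`: the inverse square root of the (diagonal, positive) matrix `Φ(I_N)`. -/
noncomputable def PhiISqrtInv {mdc : Fin (r + 1) → ℕ}
    (φ : ∀ i : Fin (r + 1), Mat r n → Matrix (Fin (mdc i + 1)) (Fin (mdc i + 1)) ℝ) :
    Matrix (DIdx r mdc) (DIdx r mdc) ℝ :=
  Matrix.diagonal fun p => (PhiMat φ (1 : Mat r n) p p) ^ (-(1 / 2) : ℝ)

/-- Polarization of a symmetric bilinear form given by a matrix. -/
theorem dotProduct_mulVec_polarization {m : ℕ} {M : Matrix (Fin m) (Fin m) ℝ} (hM : M.IsSymm)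
    (v w : Fin m → ℝ) :
    2 * (v ⬝ᵥ M *ᵥ w)
      = (v + w) ⬝ᵥ M *ᵥ (v + w) - v ⬝ᵥ M *ᵥ v - w ⬝ᵥ M *ᵥ w := by
  have h : w ⬝ᵥ M *ᵥ v = v ⬝ᵥ M *ᵥ w := by
    rw [dotProduct_mulVec, ← mulVec_transpose, hM.eq, dotProduct_comm]
  simp only [mulVec_add, add_dotProduct, dotProduct_add, h]
  ring

theorem eq_of_dotProduct_mulVec_eq {m : ℕ} {M M' : Matrix (Fin m) (Fin m) ℝ}
    (h : ∀ v w : Fin m → ℝ, v ⬝ᵥ M *ᵥ w = v ⬝ᵥ M' *ᵥ w) : M = M' := by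
  ext a b
  simpa using h (Pi.single a 1) (Pi.single b 1)

/-- The matrix obtained by bordering `D` with a corner entry `c` and zeros. -/
def bordered {m : ℕ} (c : ℝ) (D : Matrix (Fin m) (Fin m) ℝ) :
    Matrix (Fin (m + 1)) (Fin (m + 1)) ℝ :=
  Matrix.of (Fin.cons (Fin.cons c 0) fun j => Fin.cons 0 (D j))

@[simp] theorem bordered_zero_zero {m : ℕ} (c : ℝ) (D : Matrix (Fin m) (Fin m) ℝ) :
    bordered c D 0 0 = c := rfl

@[simp] theorem bordered_zero_succ {m : ℕ} (c : ℝ) (D : Matrix (Fin m) (Fin m) ℝ) (k : Fin m) :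
    bordered c D 0 k.succ = 0 := rfl

@[simp] theorem bordered_succ_zero {m : ℕ} (c : ℝ) (D : Matrix (Fin m) (Fin m) ℝ) (j : Fin m) :
    bordered c D j.succ 0 = 0 := rfl

@[simp] theorem bordered_succ_succ {m : ℕ} (c : ℝ) (D : Matrix (Fin m) (Fin m) ℝ)
    (j k : Fin m) : bordered c D j.succ k.succ = D j k := rfl

theorem bordered_inv {m : ℕ} {c : ℝ} (hc : c ≠ 0) {D : Matrix (Fin m) (Fin m) ℝ}
    (hD : IsUnit D.det) : (bordered c D)⁻¹ = bordered c⁻¹ D⁻¹ := by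
  apply Matrix.inv_eq_right_inv
  have h := Matrix.mul_nonsing_inv D hD
  ext j k
  refine Fin.cases ?_ (fun j => ?_) j <;> refine Fin.cases ?_ (fun k => ?_) k
  · simp [mul_apply, Fin.sum_univ_succ, hc]
  · simp [mul_apply, Fin.sum_univ_succ, (Fin.succ_ne_zero k).symm]
  · simp [mul_apply, Fin.sum_univ_succ, Fin.succ_ne_zero j]
  · have := congrFun (congrFun h j) k
    simpa [mul_apply, Fin.sum_univ_succ, Matrix.one_apply] using this

/-- Contribution of the first row and column to `tr (M Q M' Q)` for bordered `Q`. -/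
theorem trace_bordered {m : ℕ} {M M' : Matrix (Fin (m + 1)) (Fin (m + 1)) ℝ} (hM : M.IsSymm)
    (hM' : M'.IsSymm) (c : ℝ) {E : Matrix (Fin m) (Fin m) ℝ} (hE : E.IsSymm) :
    (M * bordered c E * M' * bordered c E).trace
      - (M.submatrix Fin.succ Fin.succ * E * M'.submatrix Fin.succ Fin.succ * E).trace
      = M 0 0 * c * (M' 0 0 * c)
        + 2 * c * ((fun j : Fin m => M j.succ 0) ⬝ᵥ E *ᵥ (fun j : Fin m => M' j.succ 0)) := by
  set b : Fin m → ℝ := fun j => M j.succ 0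
  set b' : Fin m → ℝ := fun j => M' j.succ 0
  have h0 : ∀ j : Fin m, M 0 j.succ = b j := fun j => hM.apply _ _
  have h0' : ∀ j : Fin m, M' 0 j.succ = b' j := fun j => hM'.apply _ _
  have h1 : ∀ j : Fin m, M j.succ 0 = b j := fun j => rfl
  have h1' : ∀ j : Fin m, M' j.succ 0 = b' j := fun j => rfl
  have key : ∀ N N' : Matrix (Fin (m + 1)) (Fin (m + 1)) ℝ, (N * N').trace
      = N 0 0 * N' 0 0 + ∑ j : Fin m, N 0 j.succ * N' j.succ 0
        + (∑ j : Fin m, N j.succ 0 * N' 0 j.succ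
        + (N.submatrix Fin.succ Fin.succ * N'.submatrix Fin.succ Fin.succ).trace) := by
    intro N N'
    simp only [trace, diag_apply, mul_apply, Fin.sum_univ_succ, Finset.sum_add_distrib,
      submatrix_apply]
    ring
  have hsub : ∀ N : Matrix (Fin (m + 1)) (Fin (m + 1)) ℝ,
      (N * bordered c E).submatrix Fin.succ Fin.succ = N.submatrix Fin.succ Fin.succ * E := by
    intro N
    ext j k
    simp [mul_apply, Fin.sum_univ_succ]
  have h00 : ∀ N : Matrix (Fin (m + 1)) (Fin (m + 1)) ℝ, ∀ j,
      (N * bordered c E) j 0 = N j 0 * c := by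
    intro N j
    simp [mul_apply, Fin.sum_univ_succ]
  have h0s : ∀ N : Matrix (Fin (m + 1)) (Fin (m + 1)) ℝ, ∀ k : Fin m,
      (N * bordered c E) 0 k.succ = ∑ j : Fin m, N 0 j.succ * E j k := by
    intro N j
    simp [mul_apply, Fin.sum_univ_succ]
  have hs : b' ⬝ᵥ E *ᵥ b = b ⬝ᵥ E *ᵥ b' := by
    rw [dotProduct_mulVec, ← mulVec_transpose, hE.eq, dotProduct_comm]
  rw [mul_assoc (M * bordered c E), key, hsub, hsub, mul_assoc (M.submatrix _ _ * E)]
  simp only [h00, h0s, h0, h0', h1, h1']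
  have e1 : ∑ k, (∑ j, b j * E j k) * (b' k * c) = c * (b ⬝ᵥ E *ᵥ b') := by
    rw [dotProduct_mulVec]
    simp only [dotProduct, vecMul, Finset.mul_sum]
    exact Finset.sum_congr rfl fun k _ => by ring
  have e2 : ∑ k, b k * c * (∑ j, b' j * E j k) = c * (b ⬝ᵥ E *ᵥ b') := by
    rw [← hs, dotProduct_mulVec]
    simp only [dotProduct, vecMul, Finset.mul_sum, Finset.sum_mul]
    exact Finset.sum_congr rfl fun k _ => Finset.sum_congr rfl fun j _ => by ring
  rw [e1, e2]
  ring

/-- The `k`-th block row of a matrix with partitioned rows. -/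
def rowBlk {ι : Type*} (A : Matrix (Idx r n) ι ℝ) (k : Fin (r + 1)) : Matrix (Fin (n k)) ι ℝ :=
  Matrix.of fun a b => A ⟨k, a⟩ b

theorem tip_mul_transpose {ι : Type*} [Fintype ι] (ξ : Mat r n) (A B : Matrix (Idx r n) ι ℝ) :
    tip ξ (A * Bᵀ)
      = ∑ l, ∑ k, (blk ξ l k * (rowBlk A k * (rowBlk B l)ᵀ)).trace := by
  simp only [tip, trace, diag_apply, mul_apply, Fintype.sum_sigma, transpose_apply, blk, rowBlk,
    of_apply]
  exact Finset.sum_congr rfl fun l _ => Finset.sum_comm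

theorem tip_mul_transpose_comm {ι : Type*} [Fintype ι] {ξ : Mat r n} (hξ : ξ.IsSymm)
    (A B : Matrix (Idx r n) ι ℝ) : tip ξ (A * Bᵀ) = tip ξ (B * Aᵀ) := by
  rw [tip, ← trace_transpose, transpose_mul, transpose_mul, transpose_transpose, hξ.eq,
    trace_mul_comm, tip]

theorem toW_add (i : Fin (r + 1)) (p p' : Wparam r n i) :
    toW i (p + p') = toW i p + toW i p' := by
  ext q b
  simp only [toW, of_apply, Matrix.add_apply, Prod.fst_add, Prod.snd_add, Pi.add_apply]
  split_ifs <;> simp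

theorem WGood.add {i : Fin (r + 1)} {p p' : Wparam r n i} (h : WGood V i p)
    (h' : WGood V i p') : WGood V i (p + p') :=
  ⟨fun l hl => (V l i).add_mem (h.1 l hl) (h'.1 l hl), fun l hl => by
    simp [h.2 l hl, h'.2 l hl]⟩

theorem rowBlk_toW_self (i : Fin (r + 1)) (p : Wparam r n i) :
    rowBlk (toW i p) i = p.1 • (1 : Matrix (Fin (n i)) (Fin (n i)) ℝ) := by
  ext a b
  simp [rowBlk, toW, one_apply, Fin.ext_iff]

theorem rowBlk_toW_of_ne {i k : Fin (r + 1)} {p : Wparam r n i} (hp : WGood V i p)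
    (hk : k ≠ i) : rowBlk (toW i p) k = p.2 k := by
  ext a b
  by_cases h : i < k
  · simp [rowBlk, toW, hk, h]
  · simp [rowBlk, toW, hk, h, hp.2 k h]

theorem one_mem_Zspace : (1 : Mat r n) ∈ Zspace V := by
  refine ⟨transpose_one, fun k l hkl => ?_, fun k => ⟨1, fun a b => ?_⟩⟩
  · have : blk (1 : Mat r n) l k = 0 := by
      ext a b
      simp [blk, one_apply, hkl.ne']
    rw [this]
    exact (V l k).zero_mem
  · simp [one_apply]

/-- The element of `W_i` with scalar part `1` and vanishing lower blocks. -/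
def unitW (r : ℕ) (n : Fin (r + 1) → ℕ+) (i : Fin (r + 1)) : Wparam r n i := (1, 0)

theorem unitW_good (i : Fin (r + 1)) : WGood V i (unitW r n i) :=
  ⟨fun l _ => (V l i).zero_mem, fun _ _ => rfl⟩

/-- The element of `W̌_i` formed by the lower blocks of `ξ` in the `i`-th block column. -/
def colW (i : Fin (r + 1)) (ξ : Mat r n) : Wparam r n i :=
  (0, fun l => if i < l then blk ξ l i else 0)

theorem colW_good {ξ : Mat r n} (hξ : ξ ∈ Zspace V) (i : Fin (r + 1)) :
    WGood V i (colW i ξ) :=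
  ⟨fun l hl => by simpa [colW, hl] using hξ.2.1 i l hl, fun l hl => by simp [colW, hl]⟩

theorem trace_eq_mul_bip {l k : Fin (r + 1)} (A B : Matrix (Fin (n l)) (Fin (n k)) ℝ) :
    (A * Bᵀ).trace = (n l : ℝ) * bip l A B := by
  have : (n l : ℝ) ≠ 0 := by exact_mod_cast (n l).ne_zero
  rw [bip, mul_div_cancel₀ _ this]

theorem bip_self_nonneg {l k : Fin (r + 1)} (A : Matrix (Fin (n l)) (Fin (n k)) ℝ) :
    0 ≤ bip l A A := by
  refine div_nonneg ?_ (Nat.cast_nonneg _)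
  simp only [trace, diag_apply, mul_apply, transpose_apply]
  exact Finset.sum_nonneg fun a _ => Finset.sum_nonneg fun b _ => mul_self_nonneg _

theorem blk_self_eq {ξ : Mat r n} (hξ : ξ ∈ Zspace V) (i : Fin (r + 1)) :
    blk ξ i i = tdiag ξ i • (1 : Matrix (Fin (n i)) (Fin (n i)) ℝ) := by
  obtain ⟨c, hc⟩ := hξ.2.2 i
  ext a b
  simp [blk, tdiag, hc, one_apply]

theorem tip_unitW {ξ : Mat r n} (hξ : ξ ∈ Zspace V) (i : Fin (r + 1)) :
    tip ξ (toW i (unitW r n i) * (toW i (unitW r n i))ᵀ) = (n i : ℝ) * tdiag ξ i := by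
  have h0 : ∀ k, k ≠ i → rowBlk (toW i (unitW r n i)) k = 0 :=
    fun k hk => rowBlk_toW_of_ne V (unitW_good V i) hk
  rw [tip_mul_transpose, Finset.sum_eq_single i, Finset.sum_eq_single i]
  · rw [rowBlk_toW_self, blk_self_eq V hξ]
    simp [unitW, mul_comm]
  · intro k _ hk
    simp [h0 k hk]
  · simp
  · intro l _ hl
    simp [h0 l hl]
  · simp

theorem tip_unitW_right (ξ : Mat r n) {i : Fin (r + 1)} {p : Wparam r n i} (hp : WGood V i p)
    (hp0 : p.1 = 0) :
    tip ξ (toW i (unitW r n i) * (toW i p)ᵀ)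
      = ∑ l ∈ Finset.univ.filter (fun l => i < l), (n l : ℝ) * bip l (blk ξ l i) (p.2 l) := by
  have h0 : ∀ k, k ≠ i → rowBlk (toW i (unitW r n i)) k = 0 :=
    fun k hk => rowBlk_toW_of_ne V (unitW_good V i) hk
  rw [tip_mul_transpose, Finset.sum_filter]
  refine Finset.sum_congr rfl fun l _ => ?_
  rw [Finset.sum_eq_single i _ (by simp)]
  · rw [rowBlk_toW_self]
    by_cases hl : l = i
    · subst hl
      simp [rowBlk_toW_self, hp0]
    · rw [rowBlk_toW_of_ne V hp hl]
      split_ifs with h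
      · rw [← trace_eq_mul_bip]
        simp [unitW]
      · simp [hp.2 l h]
  · intro k _ hk
    simp [h0 k hk]

theorem tip_one {i : Fin (r + 1)} {p p' : Wparam r n i} (hp : WGood V i p)
    (hp0 : p.1 = 0) (hp' : WGood V i p') :
    tip 1 (toW i p * (toW i p')ᵀ)
      = ∑ l ∈ Finset.univ.filter (fun l => i < l), (n l : ℝ) * bip l (p.2 l) (p'.2 l) := by
  rw [tip_mul_transpose, Finset.sum_filter]
  refine Finset.sum_congr rfl fun l _ => ?_
  rw [Finset.sum_eq_single l _ (by simp)]
  · have h1 : blk (1 : Mat r n) l l = 1 := by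
      ext a b
      simp [blk, one_apply]
    rw [h1, one_mul]
    by_cases hl : l = i
    · subst hl
      simp [rowBlk_toW_self, hp0]
    · rw [rowBlk_toW_of_ne V hp hl, rowBlk_toW_of_ne V hp' hl]
      split_ifs with h
      · rw [trace_eq_mul_bip]
      · simp [hp.2 l h]
  · intro k _ hk
    have h1 : blk (1 : Mat r n) l k = 0 := by
      ext a b
      simp [blk, one_apply, hk.symm]
    simp [h1]

theorem dotProduct_mulVec_eq_tip {m : ℕ} {M : Matrix (Fin m) (Fin m) ℝ} (hM : M.IsSymm)
    {ξ : Mat r n} (hξ : ξ.IsSymm) {i : Fin (r + 1)} {p p' : Wparam r n i} {v v' : Fin m → ℝ}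
    (h : v ⬝ᵥ M *ᵥ v = tip ξ (toW i p * (toW i p)ᵀ))
    (h' : v' ⬝ᵥ M *ᵥ v' = tip ξ (toW i p' * (toW i p')ᵀ))
    (hadd : (v + v') ⬝ᵥ M *ᵥ (v + v') = tip ξ (toW i (p + p') * (toW i (p + p'))ᵀ)) :
    v ⬝ᵥ M *ᵥ v' = tip ξ (toW i p * (toW i p')ᵀ) := by
  have hpol := dotProduct_mulVec_polarization hM v v'
  rw [h, h', hadd, toW_add] at hpol
  have hexp : tip ξ ((toW i p + toW i p') * (toW i p + toW i p')ᵀ)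
      = tip ξ (toW i p * (toW i p)ᵀ) + tip ξ (toW i p * (toW i p')ᵀ)
        + (tip ξ (toW i p' * (toW i p)ᵀ) + tip ξ (toW i p' * (toW i p')ᵀ)) := by
    simp only [tip, transpose_add, Matrix.add_mul, Matrix.mul_add, trace_add]
    ring
  rw [hexp, tip_mul_transpose_comm hξ (toW i p') (toW i p)] at hpol
  linarith

/-- For all `α, β ∈ 𝒵` and each non-maximal block index `i`,
`tr(φ_i(α) φ_i(I)⁻¹ φ_i(β) φ_i(I)⁻¹) - tr(φ̌_i(α) φ̌_i(I)⁻¹ φ̌_i(β) φ̌_i(I)⁻¹)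
  = α_{ii} β_{ii} + 2 Σ_{l>i} (n_l / n_i) (α_{li} | β_{li})`. -/
theorem statement3 (r : ℕ) (n : Fin (r + 1) → ℕ+)
    (V : ∀ l k : Fin (r + 1), Submodule ℝ (Matrix (Fin (n l)) (Fin (n k)) ℝ))
    (hV1 : CondV1 V) (hV2 : CondV2 V) (hV3 : CondV3 V)
    (mdc : Fin (r + 1) → ℕ)
    (hmdc : ∀ i, mdc i = ∑ l ∈ Finset.univ.filter (fun l => i < l), Module.finrank ℝ (V l i))
    (vc : ∀ i : Fin (r + 1), Wparam r n i → (Fin (mdc i + 1) → ℝ))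
    (hvclin : ∀ i, IsLinearMap ℝ (vc i))
    (hvc0 : ∀ i p, WGood V i p → vc i p 0 = p.1)
    (hvcip : ∀ i p p', WGood V i p → WGood V i p' →
      ∑ j, vc i p j * vc i p' j
        = p.1 * p'.1 + ∑ l ∈ Finset.univ.filter (fun l => i < l), bip l (p.2 l) (p'.2 l))
    (hvcsurj : ∀ i (v : Fin (mdc i + 1) → ℝ), ∃ p, WGood V i p ∧ vc i p = v)
    (φ : ∀ i : Fin (r + 1), Mat r n → Matrix (Fin (mdc i + 1)) (Fin (mdc i + 1)) ℝ)
    (hφ : ∀ i, ∀ ξ ∈ Zspace V, (φ i ξ).IsSymm ∧ ∀ p, WGood V i p →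
      vc i p ⬝ᵥ (φ i ξ).mulVec (vc i p) = tip ξ (toW i p * (toW i p)ᵀ))
    (φc : ∀ i : Fin (r + 1), Mat r n → Matrix (Fin (mdc i)) (Fin (mdc i)) ℝ)
    (hφc : ∀ i, ∀ ξ ∈ Zspace V, (φc i ξ).IsSymm ∧ ∀ p, WGood V i p → p.1 = 0 →
      (fun j => vc i p j.succ) ⬝ᵥ (φc i ξ).mulVec (fun j => vc i p j.succ)
        = tip ξ (toW i p * (toW i p)ᵀ)) :
    ∀ α ∈ Zspace V, ∀ β ∈ Zspace V, ∀ i : Fin (r + 1), i ≠ Fin.last r →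
      (φ i α * (φ i (1 : Mat r n))⁻¹ * φ i β * (φ i (1 : Mat r n))⁻¹).trace
        - (φc i α * (φc i (1 : Mat r n))⁻¹ * φc i β * (φc i (1 : Mat r n))⁻¹).trace
      = tdiag α i * tdiag β i
        + 2 * ∑ l ∈ Finset.univ.filter (fun l => i < l),
            (((n l : ℕ) : ℝ) / ((n i : ℕ) : ℝ)) * bip l (blk α l i) (blk β l i) := by
  intro α hα β hβ i _
  have hn : ∀ l, (0 : ℝ) < (n l : ℕ) := fun l => by exact_mod_cast (n l).pos
  have hlin : ∀ p p', vc i (p + p') = vc i p + vc i p' := (hvclin i).map_add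
  have h1 : (1 : Mat r n) ∈ Zspace V := one_mem_Zspace V
  have form : ∀ ξ ∈ Zspace V, ∀ p p', WGood V i p → WGood V i p' →
      vc i p ⬝ᵥ φ i ξ *ᵥ vc i p' = tip ξ (toW i p * (toW i p')ᵀ) := by
    intro ξ hξ p p' hp hp'
    obtain ⟨hs, hq⟩ := hφ i ξ hξ
    refine dotProduct_mulVec_eq_tip hs hξ.1 (hq p hp) (hq p' hp') ?_
    rw [← hlin]
    exact hq _ (hp.add V hp')
  have formc : ∀ ξ ∈ Zspace V, ∀ p p', WGood V i p → WGood V i p' → p.1 = 0 → p'.1 = 0 →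
      (fun j : Fin (mdc i) => vc i p j.succ) ⬝ᵥ φc i ξ *ᵥ (fun j => vc i p' j.succ)
        = tip ξ (toW i p * (toW i p')ᵀ) := by
    intro ξ hξ p p' hp hp' hp0 hp0'
    obtain ⟨hs, hq⟩ := hφc i ξ hξ
    refine dotProduct_mulVec_eq_tip hs hξ.1 (hq p hp hp0) (hq p' hp' hp0') ?_
    have := hq _ (hp.add V hp') (by simp [hp0, hp0'])
    rw [hlin] at this
    exact this
  have lift : ∀ v : Fin (mdc i) → ℝ, ∃ p, WGood V i p ∧ p.1 = 0 ∧
      vc i p = Fin.cons 0 v ∧ (fun j : Fin (mdc i) => vc i p j.succ) = v := by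
    intro v
    obtain ⟨p, hp, hpv⟩ := hvcsurj i (Fin.cons 0 v)
    refine ⟨p, hp, ?_, hpv, ?_⟩
    · rw [← hvc0 i p hp, hpv, Fin.cons_zero]
    · rw [hpv]
      rfl
  have hunit : vc i (unitW r n i) = Fin.cons 1 0 := by
    have hnorm := hvcip i _ _ (unitW_good V i) (unitW_good V i)
    have h0 : vc i (unitW r n i) 0 = 1 := hvc0 i _ (unitW_good V i)
    rw [Fin.sum_univ_succ, h0] at hnorm
    have hsum : ∑ j : Fin (mdc i),
        vc i (unitW r n i) j.succ * vc i (unitW r n i) j.succ = 0 := by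
      simpa [unitW, bip] using hnorm
    rw [Finset.sum_eq_zero_iff_of_nonneg fun j _ => mul_self_nonneg _] at hsum
    funext j
    refine Fin.cases h0 (fun j => ?_) j
    simpa using hsum j (Finset.mem_univ j)
  have dot_unit : ∀ (ξ : Mat r n) (v : Fin (mdc i + 1) → ℝ),
      vc i (unitW r n i) ⬝ᵥ φ i ξ *ᵥ v = ∑ k, φ i ξ 0 k * v k := by
    intro ξ v
    simp [hunit, dotProduct, mulVec, Fin.sum_univ_succ]
  have corner : ∀ ξ ∈ Zspace V, φ i ξ 0 0 = (n i : ℕ) * tdiag ξ i := by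
    intro ξ hξ
    rw [← tip_unitW V hξ, ← form ξ hξ _ _ (unitW_good V i) (unitW_good V i), dot_unit, hunit]
    simp [Fin.sum_univ_succ]
  have lower : ∀ ξ ∈ Zspace V, (φ i ξ).submatrix Fin.succ Fin.succ = φc i ξ := by
    intro ξ hξ
    refine eq_of_dotProduct_mulVec_eq fun v w => ?_
    obtain ⟨p, hp, hp0, hpv, hpv'⟩ := lift v
    obtain ⟨p', hp', hp0', hpw, hpw'⟩ := lift w
    have e := form ξ hξ p p' hp hp'
    rw [← formc ξ hξ p p' hp hp' hp0 hp0', hpv', hpw', hpv, hpw] at e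
    rw [← e]
    simp [dotProduct, mulVec, Fin.sum_univ_succ]
  have border : ∀ ξ ∈ Zspace V, (fun j : Fin (mdc i) => φ i ξ j.succ 0)
      = φc i 1 *ᵥ (fun j => vc i (colW i ξ) j.succ) := by
    intro ξ hξ
    refine dotProduct_eq _ _ fun v => ?_
    obtain ⟨p, hp, hp0, hpv, hpv'⟩ := lift v
    rw [dotProduct_comm (φc i 1 *ᵥ _) v, ← hpv', formc 1 h1 p _ hp (colW_good V hξ i) hp0 rfl,
      tip_mul_transpose_comm h1.1, tip_one V (colW_good V hξ i) rfl hp]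
    have e := form ξ hξ _ p (unitW_good V i) hp
    rw [dot_unit, tip_unitW_right V ξ hp hp0, hpv, Fin.sum_univ_succ] at e
    rw [hpv]
    simp only [Fin.cons_zero, Fin.cons_succ, mul_zero, zero_add] at e
    simp only [dotProduct, Fin.cons_succ, (hφ i ξ hξ).1.apply 0 (Fin.succ _)]
    rw [e]
    refine Finset.sum_congr rfl fun l hl => ?_
    simp [colW, (Finset.mem_filter.1 hl).2]
  have hdet : IsUnit (φc i 1).det := by
    rw [isUnit_iff_ne_zero]
    intro h
    obtain ⟨v, hv, hv0⟩ := Matrix.exists_mulVec_eq_zero_iff.2 h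
    obtain ⟨p, hp, hp0, hpv, hpv'⟩ := lift v
    have e := formc 1 h1 p p hp hp hp0 hp0
    rw [hpv', hv0, dotProduct_zero, tip_one V hp hp0 hp, eq_comm,
      Finset.sum_eq_zero_iff_of_nonneg
        fun l _ => mul_nonneg (hn l).le (bip_self_nonneg _)] at e
    have hnorm := hvcip i p p hp hp
    rw [Finset.sum_eq_zero fun l hl => (mul_eq_zero.1 (e l hl)).resolve_left (hn l).ne',
      hp0, hpv, Fin.sum_univ_succ] at hnorm
    simp only [Fin.cons_zero, Fin.cons_succ, mul_zero, zero_add] at hnorm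
    exact hv (dotProduct_self_eq_zero.1 hnorm)
  have hone : φ i 1 = bordered (n i : ℕ) (φc i 1) := by
    have hcol : colW i (1 : Mat r n) = 0 := by
      refine Prod.ext rfl (funext fun l => ?_)
      by_cases hl : i < l
      · ext a b
        simp [colW, hl, blk, one_apply, hl.ne']
      · simp [colW, hl]
    have hb : ∀ j : Fin (mdc i), φ i 1 j.succ 0 = 0 := by
      have hz := border 1 h1
      rw [hcol, (hvclin i).map_zero] at hz
      intro j
      simpa [mulVec, dotProduct] using congrFun hz j
    ext j k
    refine Fin.cases ?_ (fun j => ?_) j <;> refine Fin.cases ?_ (fun k => ?_) k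
    · simp [corner 1 h1, tdiag]
    · rw [← (hφ i 1 h1).1.apply, hb, bordered_zero_succ]
    · rw [hb, bordered_succ_zero]
    · rw [← lower 1 h1]
      rfl
  have hsinv : (φc i (1 : Mat r n))⁻¹.IsSymm := by
    rw [Matrix.IsSymm, transpose_nonsing_inv, (hφc i 1 h1).1.eq]
  rw [hone, bordered_inv (hn i).ne' hdet, ← lower α hα, ← lower β hβ,
    trace_bordered (hφ i α hα).1 (hφ i β hβ).1 _ hsinv, corner α hα, corner β hβ,
    border α hα, border β hβ, mulVec_mulVec, Matrix.nonsing_inv_mul _ hdet, one_mulVec,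
    dotProduct_comm, formc 1 h1 _ _ (colW_good V hβ i) (colW_good V hα i) rfl rfl,
    tip_mul_transpose_comm h1.1, tip_one V (colW_good V hα i) rfl (colW_good V hβ i)]
  have hni := (hn i).ne'
  congr 1
  · field_simp
  · rw [mul_assoc, Finset.mul_sum]
    congr 1
    refine Finset.sum_congr rfl fun l hl => ?_
    simp only [colW, (Finset.mem_filter.1 hl).2, if_true]
    ring

end Wishart
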